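/- If 0 < t_1 < t_2 < ⋯ < t_{n+1} and α ≤ 0, then the collocation matrix A^{(q,α)} := (A_{j-1}^{(q,α)}(t_i))_{1 ≤ i,j ≤ n+1} of the q-Abel basis is strictly totally positive. -/

import Mathlib

open Finset Matrix

noncomputable def qInt (q : ℝ) (m : ℕ) : ℝ := ∑ i ∈ Finset.range m, q ^ i

noncomputable def qFact (q : ℝ) (m : ℕ) : ℝ := ∏ i ∈ Finset.range m, qInt q (i + 1)

noncomputable def qBinom (q : ℝ) (m k : ℕ) : ℝ :=
  if k ≤ m then qFact q m / (qFact q k * qFact q (m - k)) else 0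

noncomputable def qAbel (q α : ℝ) (m : ℕ) (x : ℝ) : ℝ :=
  if m = 0 then 1 else x * ∏ j ∈ Finset.Icc 1 (m - 1), (x * q ^ j - α * qInt q m)

def IsTotallyPos {n : ℕ} (A : Matrix (Fin n) (Fin n) ℝ) : Prop :=
  ∀ (k : ℕ) (f g : Fin k → Fin n), StrictMono f → StrictMono g →
    0 ≤ (A.submatrix f g).det

def IsStrictTotallyPos {n : ℕ} (A : Matrix (Fin n) (Fin n) ℝ) : Prop :=
  ∀ (k : ℕ) (f g : Fin k → Fin n), StrictMono f → StrictMono g →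
    0 < (A.submatrix f g).det

/-- All minors of the collocation matrices (positive increasing nodes) of `F 0, …, F (N-1)`
are positive. -/
def MinorsPos (N : ℕ) (F : ℕ → ℝ → ℝ) : Prop :=
  ∀ (k : ℕ) (t : Fin k → ℝ) (g : Fin k → ℕ), StrictMono t → (∀ i, 0 < t i) → StrictMono g →
    (∀ i, g i < N) → 0 < (Matrix.of fun i j : Fin k => F (g j) (t i)).det

theorem genVandermonde_pos : ∀ (k : ℕ) (t : Fin k → ℝ) (g : Fin k → ℕ), StrictMono t →
    (∀ i, 0 < t i) → StrictMono g → 0 < (Matrix.of fun i j : Fin k => t i ^ g j).det := by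
  intro k
  induction k with
  | zero => intro t g _ _ _; simp
  | succ k ih =>
    intro t g ht hp hg
    set d : Fin k → ℕ := fun j => g j.succ - g j.castSucc with hd
    have hlt : ∀ j : Fin k, g j.castSucc < g j.succ := fun j => hg j.castSucc_lt_succ
    have hgd : ∀ j : Fin k, g j.succ = g j.castSucc + d j := by
      intro j; have := hlt j; simp only [hd]; omega
    set B : Matrix (Fin (k + 1)) (Fin (k + 1)) ℝ := Matrix.of fun i =>
      (Fin.cons (t i ^ g 0)
        (fun j : Fin k => t i ^ g j.succ - t 0 ^ d j * t i ^ g j.castSucc) : Fin (k + 1) → ℝ) with hB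
    rw [Matrix.det_eq_of_forall_col_eq_smul_add_pred (B := B) (c := fun j => t 0 ^ d j)
      (by simp [B]) (fun i j => by simp [B]), Matrix.det_succ_row_zero,
      Finset.sum_eq_single 0 _ (by simp)]
    · have h0 : B 0 0 = t 0 ^ g 0 := by simp [B]
      have hsub : B.submatrix Fin.succ (Fin.succAbove 0) = Matrix.of fun i j : Fin k =>
          (t i.succ - t 0) * (Matrix.of fun i j : Fin k => ∑ l ∈ Finset.range (d j),
            t 0 ^ (d j - 1 - l) * t i.succ ^ (g j.castSucc + l)) i j := by
        ext i j
        simp only [Matrix.submatrix_apply, Fin.succAbove_zero, B, Matrix.of_apply, Fin.cons_succ]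
        have h := geom_sum₂_mul (t i.succ) (t 0) (d j)
        rw [hgd j, pow_add]
        calc _ = t i.succ ^ g j.castSucc * (t i.succ ^ d j - t 0 ^ d j) := by ring
          _ = _ := by
            rw [← h, mul_comm (t i.succ - t 0), ← mul_assoc, Finset.mul_sum]
            congr 1
            refine Finset.sum_congr rfl fun l _ => ?_
            rw [pow_add]; ring
      rw [h0, hsub, Matrix.det_mul_column]
      have hprod : 0 < ∏ i : Fin k, (t i.succ - t 0) :=
        Finset.prod_pos fun i _ => sub_pos.2 (ht (Fin.succ_pos i))
      have hdet : 0 < (Matrix.of fun i j : Fin k => ∑ l ∈ Finset.range (d j),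
            t 0 ^ (d j - 1 - l) * t i.succ ^ (g j.castSucc + l)).det := by
        rw [← Matrix.det_transpose]
        have h := (Matrix.detRowAlternating (n := Fin k) (R := ℝ)).toMultilinearMap.map_sum_finset
          (fun (j : Fin k) (l : ℕ) => (fun i : Fin k =>
            t 0 ^ (d j - 1 - l) * t i.succ ^ (g j.castSucc + l)))
          (fun j => Finset.range (d j))
        have e : (Matrix.of fun i j : Fin k => ∑ l ∈ Finset.range (d j),
            t 0 ^ (d j - 1 - l) * t i.succ ^ (g j.castSucc + l))ᵀ =
            (fun j : Fin k => ∑ l ∈ Finset.range (d j), (fun i : Fin k =>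
            t 0 ^ (d j - 1 - l) * t i.succ ^ (g j.castSucc + l))) := by
          ext j i
          simp [Matrix.transpose_apply, Finset.sum_apply]
        rw [e]
        refine lt_of_lt_of_eq ?_ h.symm
        refine Finset.sum_pos ?_ ?_
        · intro r hr
          rw [Fintype.mem_piFinset] at hr
          have hpos := ih (fun i => t i.succ) (fun j => g j.castSucc + r j)
            (fun a b hab => ht (Fin.succ_lt_succ_iff.2 hab)) (fun i => hp _) (by
              intro a b hab
              have h1 := Finset.mem_range.1 (hr a)
              have h2 : g a.succ ≤ g b.castSucc := hg.monotone (by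
                rw [Fin.le_def]; simp; exact hab)
              have h3 := hgd a
              simp only
              omega)
          have e2 := Matrix.det_mul_column (fun j : Fin k => t 0 ^ (d j - 1 - r j))
            (Matrix.of fun i j : Fin k => t i.succ ^ (g j.castSucc + r j))ᵀ
          rw [Matrix.det_transpose] at e2
          refine lt_of_lt_of_eq ?_ e2.symm
          exact mul_pos (Finset.prod_pos fun j _ => pow_pos (hp 0) _) hpos
        · rw [Fintype.piFinset_nonempty]
          intro j
          rw [Finset.nonempty_range_iff]
          have := hlt j
          simp only [hd]; omega
      have := pow_pos (hp 0) (g 0)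
      simp only [Fin.val_zero, pow_zero, one_mul]
      positivity
    · intro j _ hj
      obtain ⟨j, rfl⟩ := j.eq_succ_of_ne_zero hj
      have : B 0 j.succ = 0 := by
        simp only [B, Matrix.of_apply, Fin.cons_succ, hgd j, pow_add]; ring
      rw [this]; simp

theorem MinorsPos.pow (N : ℕ) : MinorsPos N (fun m x => x ^ m) :=
  fun k t g ht hp hg _ => genVandermonde_pos k t g ht hp hg

theorem MinorsPos.congr {N : ℕ} {F G : ℕ → ℝ → ℝ} (hF : MinorsPos N F)
    (h : ∀ m < N, ∀ x, 0 < x → G m x = F m x) : MinorsPos N G := by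
  intro k t g ht hp hg hN
  have := hF k t g ht hp hg hN
  have e : (Matrix.of fun i j : Fin k => G (g j) (t i)) =
      Matrix.of fun i j : Fin k => F (g j) (t i) := by
    ext i j
    exact h _ (hN _) _ (hp _)
  rwa [e]

/-- One elementary column operation. -/
theorem MinorsPos.step {N : ℕ} {F G : ℕ → ℝ → ℝ} (hF : MinorsPos N F) (p : ℕ) (c b : ℝ)
    (hc : 0 < c) (hb : 0 ≤ b)
    (hne : ∀ m, m ≠ p + 1 → G m = F m)
    (hp : ∀ x, G (p + 1) x = c * F (p + 1) x + b * F p x) : MinorsPos N G := by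
  intro k t g ht htp hg hN
  by_cases hex : ∃ j, g j = p + 1
  · obtain ⟨j, hj⟩ := hex
    set M : Matrix (Fin k) (Fin k) ℝ := Matrix.of fun i j : Fin k => F (g j) (t i) with hM
    have e : (Matrix.of fun i j : Fin k => G (g j) (t i)) =
        Matrix.updateCol M j (c • (fun i => F (p + 1) (t i)) + b • (fun i => F p (t i))) := by
      ext i l
      by_cases hl : l = j
      · subst hl
        simp [hj, hp]
      · have : g l ≠ p + 1 := fun h => hl (hg.injective (h.trans hj.symm))
        simp [Matrix.updateCol_ne hl, hM, hne _ this]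
    rw [e, Matrix.det_updateCol_add, Matrix.det_updateCol_smul, Matrix.det_updateCol_smul]
    have e1 : Matrix.updateCol M j (fun i => F (p + 1) (t i)) = M := by
      ext i l
      by_cases hl : l = j
      · subst hl; simp [hM, hj]
      · simp [Matrix.updateCol_ne hl]
    rw [e1]
    have h1 := hF k t g ht htp hg hN
    have h2 : 0 ≤ (Matrix.updateCol M j (fun i => F p (t i))).det := by
      by_cases hex2 : ∃ l, g l = p
      · obtain ⟨l, hl⟩ := hex2
        have hlj : l ≠ j := by rintro rfl; omega
        refine le_of_eq (Eq.symm ?_)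
        refine Matrix.det_zero_of_column_eq hlj fun i => ?_
        simp [Matrix.updateCol_ne hlj, hM, hl]
      · push Not at hex2
        have h3 := hF k t (Function.update g j p) ht htp (by
          intro a b' hab
          have hgab := hg hab
          by_cases ha : a = j
          · subst ha
            have : b' ≠ a := hab.ne'
            simp [Function.update_of_ne this]; omega
          · by_cases hb' : b' = j
            · subst hb'
              have := hex2 a
              simp [Function.update_of_ne ha]; omega
            · simp [Function.update_of_ne ha, Function.update_of_ne hb', hgab]) (by
          intro i
          by_cases hi : i = j
          · subst hi; have := hN i; simp; omega
          · simp [Function.update_of_ne hi, hN])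
        refine le_of_lt ?_
        refine lt_of_lt_of_eq h3 (congrArg Matrix.det ?_)
        ext i l
        by_cases hl : l = j
        · subst hl; simp
        · simp [Matrix.updateCol_ne hl, hM, Function.update_of_ne hl]
    have := mul_pos hc h1
    have := mul_nonneg hb h2
    linarith
  · push Not at hex
    have := hF k t g ht htp hg hN
    have e : (Matrix.of fun i j : Fin k => G (g j) (t i)) =
        Matrix.of fun i j : Fin k => F (g j) (t i) := by
      ext i j
      simp only [Matrix.of_apply, hne _ (hex j)]
    rwa [e]

/-- A full sweep of elementary column operations. -/
theorem MinorsPos.sweep {N : ℕ} {F G : ℕ → ℝ → ℝ} (hF : MinorsPos N F) (c b : ℕ → ℝ)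
    (hc : ∀ m, 0 < c m) (hb : ∀ m, 0 ≤ b m) (h0 : G 0 = F 0)
    (hs : ∀ m x, G (m + 1) x = c m * F (m + 1) x + b m * G m x) : MinorsPos N G := by
  have key : ∀ p : ℕ, MinorsPos N (fun m => if m ≤ p then G m else F m) := by
    intro p
    induction p with
    | zero =>
      refine hF.congr fun m _ x _ => ?_
      by_cases hm : m = 0
      · subst hm; simp [h0]
      · simp [hm]
    | succ p ih =>
      refine ih.step p (c p) (b p) (hc p) (hb p) ?_ ?_
      · intro m hm
        by_cases h : m ≤ p
        · simp [h, Nat.le_succ_of_le h]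
        · have : ¬ m ≤ p + 1 := by omega
          simp [h, this]
      · intro x; simp [hs]
  refine (key N).congr fun m hm x _ => ?_
  simp [hm.le]

/-- Divided difference of the `k`-th Newton polynomial for `v` at `v a, …, v (a+s)`. -/
def newtonDD (v : ℕ → ℝ) : ℕ → ℕ → ℕ → ℝ
  | 0, _, 0 => 1
  | 0, _, _ + 1 => 0
  | k + 1, a, 0 => (v a - v k) * newtonDD v k a 0
  | k + 1, a, s + 1 => (v (a + s + 1) - v k) * newtonDD v k a (s + 1) + newtonDD v k a s

theorem newtonDD_rec (v : ℕ → ℝ) (k : ℕ) : ∀ a s, newtonDD v k (a + 1) s =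
    (v (a + s + 1) - v a) * newtonDD v k a (s + 1) + newtonDD v k a s := by
  induction k with
  | zero => intro a s; cases s <;> simp [newtonDD]
  | succ k ih =>
    intro a s
    cases s with
    | zero =>
      have := ih a 0
      simp only [newtonDD, Nat.add_zero] at *
      rw [this]; ring
    | succ s =>
      have h1 := ih a s
      have h2 := ih a (s + 1)
      simp only [newtonDD] at *
      rw [show a + 1 + s + 1 = a + (s + 1) + 1 by ring] at *
      rw [h2, h1]
      rw [show a + s + 1 = a + (s + 1) by ring] at *
      ring

theorem newtonDD_zero (v : ℕ → ℝ) (k : ℕ) : ∀ s, newtonDD v k 0 s = if k = s then 1 else 0 := by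
  induction k with
  | zero => intro s; cases s <;> simp [newtonDD]
  | succ k ih =>
    intro s
    cases s with
    | zero =>
      simp only [newtonDD, ih]
      by_cases h : k = 0
      · subst h; simp
      · simp [h]
    | succ s =>
      simp only [newtonDD, ih, Nat.zero_add]
      by_cases h : k = s + 1
      · subst h; simp
      · simp [h]

theorem newtonDD_single (v : ℕ → ℝ) (k a : ℕ) :
    newtonDD v k a 0 = ∏ j ∈ Finset.range k, (v a - v j) := by
  induction k with
  | zero => simp [newtonDD]
  | succ k ih => rw [newtonDD, ih, Finset.prod_range_succ, mul_comm]

/-- Intermediate bases. -/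
noncomputable def interm (v : ℕ → ℝ) (N : ℕ) (e : ℕ → ℝ → ℝ) (s : ℕ) : ℕ → ℝ → ℝ
  | 0, x => e 0 x
  | m + 1, x => ∑ k ∈ Finset.range N, newtonDD v k (m - s) (min s m) * e (k + 1) x

theorem interm_pos (v : ℕ → ℝ) (hv : StrictMono v) (N : ℕ) (e : ℕ → ℝ → ℝ)
    (he : MinorsPos N e) : MinorsPos N (interm v N e 0) := by
  have base : MinorsPos N (interm v N e N) := by
    refine he.congr fun m hm x _ => ?_
    cases m with
    | zero => rfl
    | succ m =>
      have h1 : m - N = 0 := by omega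
      have h2 : min N m = m := by omega
      simp only [interm, h1, h2, newtonDD_zero, ite_mul, one_mul, zero_mul]
      rw [Finset.sum_ite_eq' ]
      simp; omega
  have key : ∀ r ≤ N, MinorsPos N (interm v N e (N - r)) := by
    intro r
    induction r with
    | zero => intro _; exact base
    | succ r ih =>
      intro hr
      have ih := ih (by omega)
      obtain ⟨s, hs⟩ : ∃ s, N - r = s + 1 := ⟨N - r - 1, by omega⟩
      have hs' : N - (r + 1) = s := by omega
      rw [hs] at ih
      rw [hs']
      refine ih.sweep (fun m => if m ≤ s then 1 else v m - v (m - 1 - s))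
        (fun m => if m ≤ s then 0 else 1) ?_ ?_ ?_ ?_
      · intro m
        by_cases h : m ≤ s
        · simp [h]
        · simp only [h, if_false]
          exact sub_pos.2 (hv (by omega))
      · intro m
        by_cases h : m ≤ s <;> simp [h]
      · rfl
      · intro m x
        by_cases h : m ≤ s
        · have h1 : m - s = 0 := by omega
          have h2 : m - (s + 1) = 0 := by omega
          have h3 : min s m = m := by omega
          have h4 : min (s + 1) m = m := by omega
          simp [interm, h, h1, h2, h3, h4]
        · obtain ⟨a, rfl⟩ : ∃ a, m = a + s + 1 := ⟨m - s - 1, by omega⟩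
          have h1 : a + s + 1 - s = a + 1 := by omega
          have h2 : a + s + 1 - (s + 1) = a := by omega
          have h3 : min s (a + s + 1) = s := by omega
          have h4 : min (s + 1) (a + s + 1) = s + 1 := by omega
          have h5 : a + s + 1 - 1 - s = a := by omega
          have h6 : a + s - s = a := by omega
          have h7 : min s (a + s) = s := by omega
          simp only [interm, h, if_false, h1, h2, h3, h4, h5, h6, h7, one_mul, Finset.mul_sum]
          rw [← Finset.sum_add_distrib]
          refine Finset.sum_congr rfl fun k _ => ?_
          rw [newtonDD_rec]; ring
  simpa using key N le_rfl

theorem qInt_succ (q : ℝ) (m : ℕ) : qInt q (m + 1) = qInt q m + q ^ m := by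
  simp [qInt, Finset.sum_range_succ]

theorem qInt_succ_left (q : ℝ) (m : ℕ) : qInt q (m + 1) = 1 + q * qInt q m := by
  simp only [qInt, Finset.sum_range_succ', Finset.mul_sum, pow_succ, pow_zero]
  rw [add_comm]
  congr 1
  exact Finset.sum_congr rfl fun _ _ => mul_comm _ _

theorem qInt_pos {q : ℝ} (hq : 0 < q) (m : ℕ) : 0 < qInt q (m + 1) := by
  unfold qInt
  exact Finset.sum_pos (fun i _ => pow_pos hq i) (by simp)

theorem qInt_mul (q : ℝ) (m : ℕ) : qInt q m * (q - 1) = q ^ m - 1 := by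
  unfold qInt; exact geom_sum_mul q m

/-- Coefficients of the `q`-binomial theorem. -/
noncomputable def qCoef (q w : ℝ) (k : ℕ) : ℝ :=
  ∏ j ∈ Finset.range k, ((w - qInt q (j + 1)) / qInt q (j + 1))

theorem qCoef_shift {q : ℝ} (hq : 0 < q) (w : ℝ) (k : ℕ) :
    qCoef q (1 + q * w) (k + 1) = q ^ (k + 1) * w / qInt q (k + 1) * qCoef q w k := by
  induction k with
  | zero =>
    simp [qCoef, qInt]
  | succ k ih =>
    have h1 := (qInt_pos hq k).ne'
    have h2 := (qInt_pos hq (k + 1)).ne'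
    have e1 : qCoef q (1 + q * w) (k + 1 + 1) = qCoef q (1 + q * w) (k + 1) *
        ((1 + q * w - qInt q (k + 1 + 1)) / qInt q (k + 1 + 1)) := Finset.prod_range_succ _ _
    have e2 : qCoef q w (k + 1) = qCoef q w k *
        ((w - qInt q (k + 1)) / qInt q (k + 1)) := Finset.prod_range_succ _ _
    rw [e1, e2, ih]
    have e3 : 1 + q * w - qInt q (k + 1 + 1) = q * (w - qInt q (k + 1)) := by
      rw [qInt_succ_left q (k + 1)]; ring
    rw [e3]
    field_simp
    ring

theorem qCoef_pascal {q : ℝ} (hq : 0 < q) (m k : ℕ) :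
    qCoef q (qInt q (m + 2)) (k + 1) =
      qCoef q (qInt q (m + 1)) (k + 1) + q ^ (m + 1) * qCoef q (qInt q (m + 1)) k := by
  have h1 := (qInt_pos hq k).ne'
  have e2 : qCoef q (qInt q (m + 1)) (k + 1) = qCoef q (qInt q (m + 1)) k *
        ((qInt q (m + 1) - qInt q (k + 1)) / qInt q (k + 1)) := Finset.prod_range_succ _ _
  rw [qInt_succ_left q (m + 1), qCoef_shift hq, e2]
  have a := qInt_mul q (m + 1)
  have b := qInt_mul q (k + 1)
  have a' : q ^ (m + 1) = 1 + qInt q (m + 1) * (q - 1) := by linarith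
  have b' : q ^ (k + 1) = 1 + qInt q (k + 1) * (q - 1) := by linarith
  rw [a', b']
  field_simp
  ring

theorem qBinomial {q : ℝ} (hq : 0 < q) (y : ℝ) (m : ℕ) : ∀ N, m < N →
    ∏ j ∈ Finset.Icc 1 m, (1 + y * q ^ j) =
      ∑ k ∈ Finset.range N, y ^ k * qCoef q (qInt q (m + 1)) k := by
  induction m with
  | zero =>
    intro N hN
    rw [Finset.sum_eq_single 0]
    · simp [qCoef]
    · intro k _ hk
      have : qCoef q (qInt q (0 + 1)) k = 0 :=
        Finset.prod_eq_zero (i := 0) (Finset.mem_range.2 (Nat.pos_of_ne_zero hk)) (by simp)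
      rw [this, mul_zero]
    · intro h; exact absurd (Finset.mem_range.2 hN) h
  | succ m ih =>
    intro N hN
    obtain ⟨N, rfl⟩ : ∃ n, N = n + 1 := ⟨N - 1, by omega⟩
    rw [Finset.prod_Icc_succ_top (by omega), mul_add, mul_one]
    nth_rewrite 1 [ih (N + 1) (by omega)]
    rw [ih N (by omega), Finset.sum_range_succ', Finset.sum_range_succ', Finset.sum_mul]
    rw [add_right_comm, ← Finset.sum_add_distrib]
    congr 1
    · refine Finset.sum_congr rfl fun k _ => ?_
      rw [qCoef_pascal hq]; ring

theorem qAbel_expand {q a : ℝ} (hq : 0 < q) (ha : 0 < a) (N m : ℕ) (hm : m < N) (x : ℝ) :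
    qAbel q (-a) (m + 1) x = (a * qInt q (m + 1)) ^ m *
      ∑ k ∈ Finset.range N,
        (∏ j ∈ Finset.range k, (-(qInt q (m + 1))⁻¹ - -(qInt q (j + 1))⁻¹)) *
          ((a⁻¹) ^ k * x ^ (k + 1)) := by
  have hw := (qInt_pos hq m).ne'
  have ha' := ha.ne'
  have h := qBinomial hq (x / (a * qInt q (m + 1))) m N hm
  have e1 : qAbel q (-a) (m + 1) x = x * ((a * qInt q (m + 1)) ^ m *
      ∏ j ∈ Finset.Icc 1 m, (1 + x / (a * qInt q (m + 1)) * q ^ j)) := by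
    have : (a * qInt q (m + 1)) ^ m = ∏ j ∈ Finset.Icc 1 m, (a * qInt q (m + 1)) := by simp
    rw [this, ← Finset.prod_mul_distrib]
    simp only [qAbel, Nat.add_one_ne_zero, if_false, Nat.add_sub_cancel]
    congr 1
    refine Finset.prod_congr rfl fun j _ => ?_
    field_simp
    ring
  rw [e1, h, mul_left_comm, Finset.mul_sum]
  congr 1
  refine Finset.sum_congr rfl fun k _ => ?_
  have e2 : qCoef q (qInt q (m + 1)) k = qInt q (m + 1) ^ k *
      ∏ j ∈ Finset.range k, (-(qInt q (m + 1))⁻¹ - -(qInt q (j + 1))⁻¹) := by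
    have : qInt q (m + 1) ^ k = ∏ j ∈ Finset.range k, qInt q (m + 1) := by simp
    rw [this, ← Finset.prod_mul_distrib, qCoef]
    refine Finset.prod_congr rfl fun j _ => ?_
    have := (qInt_pos hq j).ne'
    field_simp
    ring
  rw [e2, div_pow, mul_pow, inv_pow, pow_succ]
  field_simp

theorem MinorsPos.scale {N : ℕ} {F G : ℕ → ℝ → ℝ} (hF : MinorsPos N F) (c : ℕ → ℝ)
    (hc : ∀ m, 0 < c m) (h0 : ∀ x, G 0 x = F 0 x)
    (h : ∀ m x, m + 1 < N → G (m + 1) x = c m * F (m + 1) x) : MinorsPos N G := by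
  have h1 : MinorsPos N (fun m x => if m = 0 then F 0 x else c (m - 1) * F m x) :=
    hF.sweep c (fun _ => 0) hc (fun _ => le_rfl) (by simp) (by simp)
  refine h1.congr fun m hm x _ => ?_
  cases m with
  | zero => simp [h0]
  | succ m => simp [h m x hm]

theorem qAbel_minorsPos {q α : ℝ} (hq : 0 < q) (hα : α ≤ 0) (N : ℕ) :
    MinorsPos N (qAbel q α) := by
  rcases hα.lt_or_eq with h | h
  · obtain ⟨a, rfl⟩ : ∃ a, α = -a := ⟨-α, by ring⟩
    have ha : 0 < a := by linarith
    have h1 : MinorsPos N (fun m x => (a⁻¹) ^ (m - 1) * x ^ m) :=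
      (MinorsPos.pow N).scale (fun m => (a⁻¹) ^ m) (fun m => by positivity) (by simp) (by simp)
    have hv : StrictMono (fun j : ℕ => -(qInt q (j + 1))⁻¹) := by
      refine strictMono_nat_of_lt_succ fun j => ?_
      have p1 := qInt_pos hq j
      have p2 : qInt q (j + 1) < qInt q (j + 1 + 1) := by
        rw [qInt_succ q (j + 1)]; have := pow_pos hq (j + 1); linarith
      exact neg_lt_neg (inv_strictAnti₀ p1 p2)
    refine (interm_pos _ hv N _ h1).scale (fun m => (a * qInt q (m + 1)) ^ m)
      (fun m => pow_pos (mul_pos ha (qInt_pos hq m)) _) ?_ ?_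
    · intro x; simp [qAbel, interm]
    · intro m x hm
      rw [qAbel_expand hq ha N m (by omega) x]
      simp [interm, newtonDD_single]
  · subst h
    refine (MinorsPos.pow N).scale (fun m => ∏ j ∈ Finset.Icc 1 m, q ^ j)
      (fun m => Finset.prod_pos fun j _ => pow_pos hq j) ?_ ?_
    · intro x; simp [qAbel]
    · intro m x _
      simp only [qAbel, Nat.add_one_ne_zero, if_false, Nat.add_sub_cancel, zero_mul, sub_zero,
        Finset.prod_mul_distrib, Finset.prod_const, Nat.card_Icc]
      ring

theorem qAbel_collocation_strictTotallyPos (q α : ℝ) (hq : 0 < q) (hα : α ≤ 0)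
    (n : ℕ) (t : Fin (n + 1) → ℝ) (ht0 : 0 < t 0) (ht : StrictMono t) :
    IsStrictTotallyPos
      (Matrix.of fun i j : Fin (n + 1) => qAbel q α (j : ℕ) (t i)) := by
  intro k f g hf hg
  exact qAbel_minorsPos hq hα (n + 1) k (fun i => t (f i)) (fun j => (g j : ℕ))
    (ht.comp hf) (fun i => lt_of_lt_of_le ht0 (ht.monotone (Fin.zero_le _)))
    (fun a b hab => hg hab) (fun i => (g i).isLt)
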